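/- Let V and E be finite types, src, tgt : E → V, w : E → ℤ, and fix a source node s. Suppose no negative-weight cycle is reachable from s. Then for every node t and every walk P from s to t, there exists a walk Q from s to t of length at most |V| − 1 whose weight is less than or equal to the weight of P. -/

import Mathlib

namespace BFPaper

variable {V E : Type*}

/-- `IsWalk src tgt u v es` : the list of edges `es` forms a walk from `u` to `v`
in the directed multigraph given by source and target maps `src tgt : E → V`. -/
inductive IsWalk (src tgt : E → V) : V → V → List E → Prop
  | nil (u : V) : IsWalk src tgt u u []
  | cons {v : V} (e : E) {es : List E} (h : IsWalk src tgt (tgt e) v es) :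
      IsWalk src tgt (src e) v (e :: es)

/-- The weight of a walk: the sum of the weights of its edges. -/
def weight (w : E → ℤ) (es : List E) : ℤ := (es.map w).sum

/-- `v` is reachable from `s` if there is a walk from `s` to `v`. -/
def Reachable (src tgt : E → V) (s v : V) : Prop :=
  ∃ es : List E, IsWalk src tgt s v es

/-- There is a negative-weight cycle reachable from `s`. -/
def HasNegCycleFrom (src tgt : E → V) (w : E → ℤ) (s : V) : Prop :=
  ∃ (u : V) (es : List E), es ≠ [] ∧ IsWalk src tgt u u es ∧
    weight w es < 0 ∧ Reachable src tgt s u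

/-- The Bellman-Ford distance function `d : ℕ → V → WithTop ℤ`. -/
def bfDist [Fintype E] [DecidableEq V] (src tgt : E → V) (w : E → ℤ) (s : V) :
    ℕ → V → WithTop ℤ
  | 0 => fun v => if v = s then (0 : WithTop ℤ) else ⊤
  | (k+1) => fun v =>
      min (bfDist src tgt w s k v)
        (Finset.univ.inf fun e : E =>
          if tgt e = v then bfDist src tgt w s k (src e) + (w e : WithTop ℤ) else ⊤)

end BFPaper

namespace BFPaper

variable {V E : Type*} {src tgt : E → V}

theorem weight_append (w : E → ℤ) (as bs : List E) :
    weight w (as ++ bs) = weight w as + weight w bs := by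
  simp [weight]

theorem IsWalk.append {u v x : V} {as bs : List E} (ha : IsWalk src tgt u v as)
    (hb : IsWalk src tgt v x bs) : IsWalk src tgt u x (as ++ bs) := by
  induction ha with
  | nil => exact hb
  | cons e _ ih => exact .cons e (ih hb)

/-- A walk can be split at any node that one of its edges enters. -/
theorem IsWalk.exists_split_of_mem {u v x : V} {es : List E} (h : IsWalk src tgt u v es)
    (hx : x ∈ es.map tgt) :
    ∃ as bs, es = as ++ bs ∧ as ≠ [] ∧ IsWalk src tgt u x as ∧ IsWalk src tgt x v bs := by
  induction h with
  | nil => simp at hx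
  | @cons v e es h ih =>
    rcases List.mem_cons.1 hx with rfl | hx
    · exact ⟨[e], es, rfl, by simp, .cons e (.nil _), h⟩
    · obtain ⟨as, bs, rfl, -, ha, hb⟩ := ih hx
      exact ⟨e :: as, bs, rfl, by simp, .cons e ha, hb⟩

/-- A walk that visits some node twice contains a nonempty closed subwalk. -/
theorem IsWalk.exists_cycle_of_not_nodup {u v : V} {es : List E} (h : IsWalk src tgt u v es)
    (hd : ¬ (u :: es.map tgt).Nodup) :
    ∃ x as bs cs, es = as ++ (bs ++ cs) ∧ bs ≠ [] ∧ IsWalk src tgt u x as ∧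
      IsWalk src tgt x x bs ∧ IsWalk src tgt x v cs := by
  induction h with
  | nil => simp at hd
  | @cons v e es h ih =>
    by_cases hm : src e ∈ (e :: es).map tgt
    · obtain ⟨bs, cs, heq, hne, hb, hc⟩ := (IsWalk.cons e h).exists_split_of_mem hm
      exact ⟨src e, [], bs, cs, heq, hne, .nil _, hb, hc⟩
    · obtain ⟨x, as, bs, cs, rfl, hne, ha, hb, hc⟩ :=
        ih fun hn => hd (List.nodup_cons.2 ⟨hm, hn⟩)
      exact ⟨x, e :: as, bs, cs, rfl, hne, .cons e ha, hb, hc⟩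

end BFPaper

/-- If no negative-weight cycle is reachable from `s`, then every walk from `s` to `t`
can be replaced by a walk of length at most `|V| - 1` of at most the same weight. -/
theorem exists_short_walk_le_weight
    (V E : Type*) [Fintype V] [Fintype E] (src tgt : E → V) (w : E → ℤ) (s : V)
    (hnc : ¬ BFPaper.HasNegCycleFrom src tgt w s) :
    ∀ (t : V) (P : List E), BFPaper.IsWalk src tgt s t P →
      ∃ Q : List E, BFPaper.IsWalk src tgt s t Q ∧
        Q.length ≤ Fintype.card V - 1 ∧
        BFPaper.weight w Q ≤ BFPaper.weight w P := by
  intro t P hP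
  induction hn : P.length using Nat.strong_induction_on generalizing P with
  | _ n ih =>
    subst hn
    by_cases hlen : P.length ≤ Fintype.card V - 1
    · exact ⟨P, hP, hlen, le_rfl⟩
    have hd : ¬ (s :: P.map tgt).Nodup := fun hn => by
      have := hn.length_le_card
      simp only [List.length_cons, List.length_map] at this
      omega
    obtain ⟨x, as, bs, cs, rfl, hne, ha, hb, hc⟩ := hP.exists_cycle_of_not_nodup hd
    have hw : 0 ≤ BFPaper.weight w bs :=
      not_lt.1 fun hneg => hnc ⟨x, bs, hne, hb, hneg, as, ha⟩
    have hpos := List.length_pos_of_ne_nil hne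
    obtain ⟨Q, hQ, hQlen, hQw⟩ :=
      ih (as ++ cs).length (by simp only [List.length_append]; omega) (as ++ cs) (ha.append hc) rfl
    refine ⟨Q, hQ, hQlen, hQw.trans ?_⟩
    simp only [BFPaper.weight_append]
    linarith
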